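/- There exists a constant C > 0 such that for every integer n ≥ 8 one has Δ_{7,7}(n) ≤ C · n^{−1.792}; equivalently, every n-element subset of [0,1]^7 contains 8 points spanning a 7-dimensional simplex of volume at most C · n^{−1.792}. -/

import Mathlib

open scoped RealInnerProductSpace

/-- The Gram matrix of a collection of `k` vectors in `ℝ^d`. -/
noncomputable def gram {d k : ℕ} (v : Fin k → EuclideanSpace ℝ (Fin d)) :
    Matrix (Fin k) (Fin k) ℝ :=
  Matrix.of fun i j => ⟪v i, v j⟫

/-- `vol v` is the `k`-dimensional volume of the parallelepiped spanned by
`v 1, …, v k`, i.e. the square root of the determinant of their Gram matrix.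
For `k = 0` it equals `1`. -/
noncomputable def vol {d k : ℕ} (v : Fin k → EuclideanSpace ℝ (Fin d)) : ℝ :=
  Real.sqrt (gram v).det

/-- The `k`-dimensional volume of the simplex with vertices `p 0, …, p k`. -/
noncomputable def simplexVol {d k : ℕ} (p : Fin (k + 1) → EuclideanSpace ℝ (Fin d)) : ℝ :=
  (Nat.factorial k : ℝ)⁻¹ * vol (fun i : Fin k => p i.succ - p 0)

/-- The minimum, over all `(k+1)`-element subsets of `X`, of the `k`-dimensional
volume of the simplex they span. -/
noncomputable def minSimplexVol (d k : ℕ) (X : Finset (EuclideanSpace ℝ (Fin d))) : ℝ :=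
  sInf { v : ℝ | ∃ p : Fin (k + 1) → EuclideanSpace ℝ (Fin d),
    Function.Injective p ∧ (∀ i, p i ∈ X) ∧ v = simplexVol p }

/-- `Delta k d n` is the supremum, over all `n`-element subsets `X` of the unit cube
`[0,1]^d`, of the minimum `k`-dimensional simplex volume among `(k+1)`-element
subsets of `X`. -/
noncomputable def Delta (k d n : ℕ) : ℝ :=
  sSup { v : ℝ | ∃ X : Finset (EuclideanSpace ℝ (Fin d)), X.card = n ∧
    (∀ x ∈ X, ∀ i, x i ∈ Set.Icc (0 : ℝ) 1) ∧ v = minSimplexVol d k X }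

theorem rpow_neg_le_of_le_mul {m m' c a : ℝ} (hm : 0 < m) (hc : 0 < c) (ha : 0 ≤ a)
    (h : m ≤ c * m') : m' ^ (-a) ≤ c ^ a * m ^ (-a) := by
  have h1 : m / c ≤ m' := by rw [div_le_iff₀ hc]; linarith
  calc m' ^ (-a) ≤ (m / c) ^ (-a) :=
        Real.rpow_le_rpow_of_nonpos (by positivity) h1 (by linarith)
    _ = c ^ a * m ^ (-a) := by
        rw [Real.div_rpow hm.le hc.le, Real.rpow_neg hc.le, div_inv_eq_mul, mul_comm]

theorem exists_card_le_mul_card_fiber {ι : Type} {d : ℕ} (T : Finset ι) (f : ι → Fin (d + 1)) :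
    ∃ j, (T.card : ℝ) ≤ (d + 1) * (T.filter fun i => f i = j).card := by
  obtain ⟨j, -, hj⟩ := Finset.exists_le_card_fiber_of_nsmul_le_card_of_maps_to
    (s := T) (t := Finset.univ) (f := f) (b := (T.card : ℝ) / (d + 1))
    (fun _ _ => Finset.mem_univ _) Finset.univ_nonempty (by
      simp only [Finset.card_univ, Fintype.card_fin, nsmul_eq_mul]
      push_cast
      rw [mul_div_cancel₀ _ (by positivity)])
  refine ⟨j, ?_⟩
  rw [div_le_iff₀ (by positivity)] at hj
  linarith

/-- Pigeonhole in a cube divided into small cells. -/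
theorem exists_ne_norm_sub_le {ι : Type} {d : ℕ} {B : ℝ} (hB : 0 < B) (T : Finset ι)
    (u : ι → Fin (d + 1) → ℝ) (hu : ∀ i ∈ T, ‖u i‖ ≤ B) (hT : 2 ≤ T.card) :
    ∃ i ∈ T, ∃ j ∈ T, i ≠ j ∧ ‖u i - u j‖ ≤ 8 * B * (T.card : ℝ) ^ (-(1 / (d + 1 : ℝ))) := by
  set r : ℝ := (T.card : ℝ) ^ (1 / (d + 1 : ℝ)) with hr
  have hT0 : (0 : ℝ) < T.card := by
    have : 0 < T.card := by omega
    exact_mod_cast this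
  have hr0 : 0 < r := Real.rpow_pos_of_pos hT0 _
  rw [Real.rpow_neg hT0.le, ← hr]
  rcases lt_or_ge r 4 with h4 | h4
  · obtain ⟨i, hi, j, hj, hij⟩ := Finset.one_lt_card.mp (show 1 < T.card by omega)
    refine ⟨i, hi, j, hj, hij, ?_⟩
    have h1 : ‖u i - u j‖ ≤ 2 * B := by
      have := norm_sub_le (u i) (u j)
      linarith [hu i hi, hu j hj]
    refine h1.trans ?_
    rw [← div_eq_mul_inv, le_div_iff₀ hr0]
    nlinarith
  · obtain ⟨K, hK⟩ : ∃ K : ℕ, ⌈r⌉₊ = K + 2 := by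
      have : (4 : ℝ) ≤ ⌈r⌉₊ := h4.trans (Nat.le_ceil r)
      have h' : 4 ≤ ⌈r⌉₊ := by exact_mod_cast this
      exact ⟨⌈r⌉₊ - 2, by omega⟩
    have hK1 : (K : ℝ) + 1 < r := by
      have := Nat.ceil_lt_add_one hr0.le
      rw [hK] at this
      push_cast at this
      linarith
    have hK2 : r / 2 ≤ K := by
      have := Nat.le_ceil r
      rw [hK] at this
      push_cast at this
      linarith
    have hK0 : (0 : ℝ) < K := by linarith
    have hrd : r ^ (d + 1) = T.card := by
      rw [hr, ← Real.rpow_natCast, ← Real.rpow_mul hT0.le]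
      push_cast
      rw [one_div, inv_mul_cancel₀ (by positivity), Real.rpow_one]
    have hcard : (K + 1) ^ (d + 1) < T.card := by
      have : ((K : ℝ) + 1) ^ (d + 1) < r ^ (d + 1) :=
        pow_lt_pow_left₀ hK1 (by positivity) (by omega)
      rw [hrd] at this
      exact_mod_cast this
    have hco : ∀ i ∈ T, ∀ k, |u i k| ≤ B := fun i hi k =>
      (Real.norm_eq_abs (u i k) ▸ norm_le_pi_norm (u i) k).trans (hu i hi)
    have hnn : ∀ i ∈ T, ∀ k, 0 ≤ (u i k + B) * K / (2 * B) := fun i hi k => by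
      have := abs_le.mp (hco i hi k)
      have : 0 ≤ u i k + B := by linarith
      positivity
    obtain ⟨i, hi, j, hj, hij, hf⟩ := Finset.exists_ne_map_eq_of_card_lt_of_maps_to
      (s := T) (t := Fintype.piFinset fun _ : Fin (d + 1) => Finset.range (K + 1))
      (f := fun i k => ⌊(u i k + B) * K / (2 * B)⌋₊) (by simpa using hcard) (by
        intro i hi
        simp only [Finset.mem_coe, Fintype.mem_piFinset, Finset.mem_range, Nat.lt_succ_iff]
        intro k
        have := abs_le.mp (hco i hi k)
        refine Nat.floor_le_of_le ?_
        rw [div_le_iff₀ (by positivity)]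
        nlinarith)
    refine ⟨i, hi, j, hj, hij, ?_⟩
    refine (pi_norm_le_iff_of_nonneg (by positivity)).mpr fun k => ?_
    have hk : ⌊(u i k + B) * K / (2 * B)⌋₊ = ⌊(u j k + B) * K / (2 * B)⌋₊ := congrFun hf k
    have e1 := Nat.floor_le (hnn i hi k)
    have e2 := Nat.lt_floor_add_one ((u i k + B) * K / (2 * B))
    have e3 := Nat.floor_le (hnn j hj k)
    have e4 := Nat.lt_floor_add_one ((u j k + B) * K / (2 * B))
    rw [hk] at e1 e2
    have h5 : |(u i k - u j k) * K / (2 * B)| ≤ 1 := by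
      have : (u i k - u j k) * K / (2 * B) =
        (u i k + B) * K / (2 * B) - (u j k + B) * K / (2 * B) := by ring
      rw [this, abs_le]
      constructor <;> linarith
    rw [abs_div, abs_mul, abs_of_pos hK0, abs_of_pos (by positivity : 0 < 2 * B),
      div_le_one (by positivity)] at h5
    rw [Pi.sub_apply, Real.norm_eq_abs, ← div_eq_mul_inv, le_div_iff₀ hr0]
    calc |u i k - u j k| * r ≤ |u i k - u j k| * (2 * K) := by gcongr; linarith
      _ ≤ 8 * B := by linarith

theorem exists_eq_smul_of_norm_eq_one {d : ℕ} (v : Fin (d + 1) → ℝ) :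
    ∃ (j : Fin (d + 1)) (t : ℝ) (w : Fin (d + 1) → ℝ), v = t • w ∧ w j = 1 ∧ ‖w‖ = 1 := by
  by_cases hv : v = 0
  · exact ⟨0, 0, fun _ => 1, by simp [hv], rfl, by simp⟩
  · obtain ⟨j, hj⟩ := Finite.exists_max fun i => ‖v i‖
    have hj' : ‖v j‖ = ‖v‖ :=
      le_antisymm (norm_le_pi_norm v j) ((pi_norm_le_iff_of_nonneg (norm_nonneg _)).mpr hj)
    have h0 : v j ≠ 0 := by
      rw [← norm_ne_zero_iff, hj', norm_ne_zero_iff]; exact hv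
    refine ⟨j, v j, (v j)⁻¹ • v, ?_, ?_, ?_⟩
    · rw [smul_smul, mul_inv_cancel₀ h0, one_smul]
    · simp [h0]
    · rw [norm_smul, norm_inv, hj', inv_mul_cancel₀]
      rwa [norm_ne_zero_iff]

/-- The projection of `ℝ^(d+1)` to the coordinate hyperplane `x_j = 0` along `w`,
provided that `w j = 1`. -/
def pivotMap {d : ℕ} (j : Fin (d + 1)) (w : Fin (d + 1) → ℝ) :
    (Fin (d + 1) → ℝ) →ₗ[ℝ] (Fin d → ℝ) where
  toFun y k := y (j.succAbove k) - y j * w (j.succAbove k)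
  map_add' x y := by ext k; simp only [Pi.add_apply]; ring
  map_smul' t y := by ext k; simp only [Pi.smul_apply, smul_eq_mul, RingHom.id_apply]; ring

theorem pivotMap_apply {d : ℕ} (j : Fin (d + 1)) (w y : Fin (d + 1) → ℝ) (k : Fin d) :
    pivotMap j w y k = y (j.succAbove k) - y j * w (j.succAbove k) := rfl

theorem abs_det_cons_eq_pivotMap {d : ℕ} {j : Fin (d + 1)} {w : Fin (d + 1) → ℝ} (hw : w j = 1)
    (y : Fin d → Fin (d + 1) → ℝ) :
    |(Matrix.of (Fin.cons w y : Fin (d + 1) → Fin (d + 1) → ℝ)).det| =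
      |(Matrix.of fun i => pivotMap j w (y i)).det| := by
  have h1 : (Matrix.of (Fin.cons w y : Fin (d + 1) → Fin (d + 1) → ℝ)).det =
      (Matrix.of (Fin.cons w (fun i => y i - y i j • w) : Fin (d + 1) → Fin (d + 1) → ℝ)).det := by
    refine Matrix.det_eq_of_forall_row_eq_smul_add_const (Fin.cons 0 fun i => y i j) 0
      (Fin.cons_zero _ _) fun i k => ?_
    refine Fin.cases ?_ (fun i => ?_) i <;> simp
  rw [h1, Matrix.det_succ_column _ j, Fin.sum_univ_succ]
  simp only [Matrix.of_apply, Fin.cons_zero, Fin.cons_succ, hw, Pi.sub_apply, Pi.smul_apply,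
    smul_eq_mul, mul_one, sub_self, mul_zero, zero_mul, Finset.sum_const_zero, add_zero,
    abs_mul, abs_pow, abs_neg, abs_one, one_pow, one_mul]
  congr 2

theorem exists_linearMap_abs_det_cons {d : ℕ} (v : Fin (d + 1) → ℝ) :
    ∃ L : (Fin (d + 1) → ℝ) →ₗ[ℝ] (Fin d → ℝ), L v = 0 ∧ (∀ y, ‖L y‖ ≤ 2 * ‖y‖) ∧
      ∀ (t : ℝ) (y : Fin d → Fin (d + 1) → ℝ),
        |(Matrix.of (Fin.cons (t • v) y : Fin (d + 1) → Fin (d + 1) → ℝ)).det| =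
          |t| * ‖v‖ * |(Matrix.of fun i => L (y i)).det| := by
  obtain ⟨j, s, w, rfl, hj, hw⟩ := exists_eq_smul_of_norm_eq_one v
  refine ⟨pivotMap j w, ?_, fun y => ?_, fun t y => ?_⟩
  · ext k
    simp [pivotMap_apply, hj]
  · refine (pi_norm_le_iff_of_nonneg (by positivity)).mpr fun k => ?_
    rw [pivotMap_apply]
    have h1 := norm_le_pi_norm y (j.succAbove k)
    have h2 := norm_le_pi_norm y j
    have h3 := norm_le_pi_norm w (j.succAbove k)
    rw [hw] at h3
    calc ‖y (j.succAbove k) - y j * w (j.succAbove k)‖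
        ≤ ‖y (j.succAbove k)‖ + ‖y j‖ * ‖w (j.succAbove k)‖ := by
          rw [← norm_mul]; exact norm_sub_le _ _
      _ ≤ ‖y‖ + ‖y‖ * 1 := by gcongr
      _ = 2 * ‖y‖ := by ring
  · rw [← abs_det_cons_eq_pivotMap hj, norm_smul, hw, mul_one, Real.norm_eq_abs, ← abs_mul,
      ← abs_mul, smul_smul]
    congr 1
    have := Matrix.det_updateRow_smul
      (Matrix.of (Fin.cons w y : Fin (d + 1) → Fin (d + 1) → ℝ)) 0 (t * s) w
    convert this using 2
    · ext i k
      refine Fin.cases ?_ (fun i => ?_) i <;> simp [Matrix.updateRow_apply]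
    · congr 1
      ext i k
      refine Fin.cases ?_ (fun i => ?_) i <;> simp [Matrix.updateRow_apply]

/-- Every large finite family of points of `ℝ^d` of sup norm at most `B` contains a simplex of
volume `O(n^(-a))`. -/
def SimplexBound (d : ℕ) (a : ℝ) : Prop :=
  ∀ B : ℝ, 0 < B → ∃ C N : ℝ, 0 < C ∧ ∀ (ι : Type) (T : Finset ι) (u : ι → Fin d → ℝ),
    (∀ i ∈ T, ‖u i‖ ≤ B) → N ≤ T.card →
    ∃ s : Fin (d + 1) → ι, Function.Injective s ∧ (∀ i, s i ∈ T) ∧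
      |(Matrix.of fun i : Fin d => u (s i.succ) - u (s 0)).det| ≤ C * (T.card : ℝ) ^ (-a)

/-- Every large finite family of points of `ℝ^d` of sup norm at most `B` contains `d` points
which together with the origin span a simplex of volume `O(n^(-a))`. -/
def ConeBound (d : ℕ) (a : ℝ) : Prop :=
  ∀ B : ℝ, 0 < B → ∃ C N : ℝ, 0 < C ∧ ∀ (ι : Type) (T : Finset ι) (u : ι → Fin d → ℝ),
    (∀ i ∈ T, ‖u i‖ ≤ B) → N ≤ T.card →
    ∃ s : Fin d → ι, Function.Injective s ∧ (∀ i, s i ∈ T) ∧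
      |(Matrix.of fun i => u (s i)).det| ≤ C * (T.card : ℝ) ^ (-a)

theorem simplexBound_one : SimplexBound 1 1 := by
  intro B hB
  refine ⟨8 * B, 2, by positivity, fun ι T u hu hT => ?_⟩
  obtain ⟨i, hi, j, hj, hij, h⟩ :=
    exists_ne_norm_sub_le (d := 0) hB T u hu (by exact_mod_cast hT)
  refine ⟨![j, i], ?_, ?_, ?_⟩
  · intro x y hxy
    fin_cases x <;> fin_cases y <;> simp_all [eq_comm]
  · intro x
    fin_cases x <;> simp [hi, hj]
  · have h1 := norm_le_pi_norm (u i - u j) 0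
    simp only [Nat.cast_zero, zero_add, div_one] at h
    simpa using h1.trans h

/-- Central projection from the origin to a coordinate hyperplane. -/
theorem SimplexBound.coneBound {d : ℕ} {a : ℝ} (ha : 0 ≤ a) (h : SimplexBound d a) :
    ConeBound (d + 1) a := by
  intro B hB
  obtain ⟨C, N, hC, h⟩ := h 1 one_pos
  refine ⟨B ^ (d + 1) * (C * (d + 1) ^ a), max 1 ((d + 1) * N), by positivity,
    fun ι T u hu hT => ?_⟩
  choose j t w hv hj hw using fun i => exists_eq_smul_of_norm_eq_one (u i)
  obtain ⟨k, hk⟩ := exists_card_le_mul_card_fiber T j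
  have hT1 : (0 : ℝ) < T.card := one_pos.trans_le ((le_max_left _ _).trans hT)
  obtain ⟨s, hs, hsT, hdet⟩ := h ι (T.filter fun i => j i = k)
    (fun i m => w i (k.succAbove m)) (fun i _ => by
      refine (pi_norm_le_iff_of_nonneg zero_le_one).mpr fun m => ?_
      exact (norm_le_pi_norm (w i) _).trans (hw i).le) (by
      have := (le_max_right _ _).trans (hT.trans hk)
      exact le_of_mul_le_mul_left this (by positivity))
  simp only [Finset.mem_filter] at hsT
  refine ⟨s, hs, fun i => (hsT i).1, ?_⟩
  have e1 : (Matrix.of fun i => u (s i)).det = (∏ i, t (s i)) * (Matrix.of fun i => w (s i)).det := by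
    rw [← Matrix.det_mul_column]
    congr 1
    ext i m
    simp only [Matrix.of_apply]
    rw [hv (s i)]
    simp
  have hj' : ∀ i, w (s i) k = 1 := fun i => by rw [← (hsT i).2]; exact hj _
  have e2 : |(Matrix.of fun i => w (s i)).det| ≤ C * (d + 1) ^ a * (T.card : ℝ) ^ (-a) := by
    have : (fun i => w (s i)) = Fin.cons (w (s 0)) (fun i : Fin d => w (s i.succ)) := by
      ext i m
      refine Fin.cases ?_ (fun i => ?_) i <;> simp
    rw [this, abs_det_cons_eq_pivotMap (hj' 0)]
    have e3 : (fun i : Fin d => pivotMap k (w (s 0)) (w (s i.succ))) = fun i : Fin d =>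
        (fun m => w (s i.succ) (k.succAbove m)) - (fun m => w (s 0) (k.succAbove m)) := by
      ext i m
      simp [pivotMap_apply, hj']
    rw [e3]
    refine hdet.trans ?_
    rw [mul_assoc]
    gcongr
    exact rpow_neg_le_of_le_mul hT1 (by positivity) ha hk
  have e4 : |∏ i, t (s i)| ≤ B ^ (d + 1) := by
    rw [Finset.abs_prod]
    calc ∏ i, |t (s i)| ≤ ∏ _i : Fin (d + 1), B := by
          refine Finset.prod_le_prod (fun _ _ => abs_nonneg _) fun i _ => ?_
          have := hu (s i) (hsT i).1
          rwa [hv (s i), norm_smul, hw, mul_one, Real.norm_eq_abs] at this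
      _ = B ^ (d + 1) := by simp
  rw [e1, abs_mul, mul_assoc (B ^ (d + 1))]
  gcongr

theorem ConeBound.simplexBound_pair {d : ℕ} {a : ℝ} (ha : 0 ≤ a) (h : ConeBound d a) :
    SimplexBound (d + 1) (1 / (d + 1 : ℝ) + a) := by
  classical
  intro B hB
  obtain ⟨C, N, hC, h⟩ := h (4 * B) (by positivity)
  refine ⟨8 * B * (C * 2 ^ a), max 4 (2 * N), by positivity, fun ι T u hu hT => ?_⟩
  have hT4 : (4 : ℝ) ≤ T.card := (le_max_left _ _).trans hT
  have hT0 : (0 : ℝ) < T.card := by linarith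
  have hT4' : 4 ≤ T.card := by exact_mod_cast hT4
  obtain ⟨i, hi, j, hj, hij, hd⟩ := exists_ne_norm_sub_le hB T u hu (by omega)
  obtain ⟨L, -, hL, hdet⟩ := exists_linearMap_abs_det_cons (u j - u i)
  have hcard : (T.card : ℝ) ≤ 2 * (T \ {i, j}).card := by
    have h1 := Finset.le_card_sdiff {i, j} T
    have h2 : ({i, j} : Finset ι).card ≤ 2 := Finset.card_le_two
    have : T.card ≤ 2 * (T \ {i, j}).card := by omega
    exact_mod_cast this
  obtain ⟨s, hs, hsT, hb⟩ := h ι (T \ {i, j}) (fun m => L (u m - u i)) (fun m hm => by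
      have h1 := hu m (Finset.sdiff_subset hm)
      have h2 := norm_sub_le (u m) (u i)
      linarith [hL (u m - u i), hu i hi]) (by
      linarith [(le_max_right _ _).trans hT])
  simp only [Finset.mem_sdiff, Finset.mem_insert, Finset.mem_singleton, not_or] at hsT
  refine ⟨Fin.cons i (Fin.cons j s), ?_, ?_, ?_⟩
  · rw [Fin.cons_injective_iff, Fin.cons_injective_iff]
    refine ⟨?_, ?_, hs⟩
    · rintro ⟨x, hx⟩
      revert hx
      refine Fin.cases ?_ (fun x => ?_) x
      · simpa using hij.symm
      · simpa using (hsT x).2.1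
    · rintro ⟨x, hx⟩
      exact (hsT x).2.2 hx
  · intro x
    refine Fin.cases hi (fun x => Fin.cases hj (fun x => ?_) x) x
    simpa using (hsT x).1
  · have e1 : (fun m : Fin (d + 1) => u ((Fin.cons i (Fin.cons j s) : Fin (d + 2) → ι) m.succ) -
        u ((Fin.cons i (Fin.cons j s) : Fin (d + 2) → ι) 0)) =
        Fin.cons ((1 : ℝ) • (u j - u i)) (fun m => u (s m) - u i) := by
      ext m k
      refine Fin.cases ?_ (fun m => ?_) m <;> simp
    rw [e1, hdet, abs_one, one_mul, norm_sub_rev, neg_add, Real.rpow_add hT0]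
    calc _ ≤ (8 * B * (T.card : ℝ) ^ (-(1 / (d + 1 : ℝ)))) *
          (C * (2 ^ a * (T.card : ℝ) ^ (-a))) := by
          gcongr
          refine hb.trans ?_
          gcongr
          exact rpow_neg_le_of_le_mul hT0 two_pos ha hcard
      _ = _ := by ring

theorem exists_disjoint_pairs {ι : Type} [DecidableEq ι] (T : Finset ι) (R : ι → ι → Prop)
    (hT : 4 ≤ T.card)
    (h : ∀ S ⊆ T, T.card ≤ 2 * S.card → ∃ i ∈ S, ∃ j ∈ S, i ≠ j ∧ R i j) :
    ∃ P : Finset (ι × ι), T.card ≤ 8 * P.card ∧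
      (∀ p ∈ P, p.1 ∈ T ∧ p.2 ∈ T ∧ p.1 ≠ p.2 ∧ R p.1 p.2) ∧
      ∀ p ∈ P, ∀ q ∈ P, p ≠ q → p.1 ≠ q.1 ∧ p.1 ≠ q.2 ∧ p.2 ≠ q.1 ∧ p.2 ≠ q.2 := by
  have key : ∀ k : ℕ, 4 * k ≤ T.card → ∃ P : Finset (ι × ι), P.card = k ∧
      (∀ p ∈ P, p.1 ∈ T ∧ p.2 ∈ T ∧ p.1 ≠ p.2 ∧ R p.1 p.2) ∧
      ∀ p ∈ P, ∀ q ∈ P, p ≠ q → p.1 ≠ q.1 ∧ p.1 ≠ q.2 ∧ p.2 ≠ q.1 ∧ p.2 ≠ q.2 := by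
    intro k
    induction k with
    | zero => exact fun _ => ⟨∅, by simp⟩
    | succ k ih =>
      intro hk
      obtain ⟨P, hP, hP1, hP2⟩ := ih (by omega)
      obtain ⟨i, hi, j, hj, hij, hR⟩ := h (T \ (P.image Prod.fst ∪ P.image Prod.snd))
        Finset.sdiff_subset (by
          have h1 := Finset.le_card_sdiff (P.image Prod.fst ∪ P.image Prod.snd) T
          have h2 := Finset.card_union_le (P.image Prod.fst) (P.image Prod.snd)
          have h3 := Finset.card_image_le (s := P) (f := Prod.fst)
          have h4 := Finset.card_image_le (s := P) (f := Prod.snd)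
          omega)
      simp only [Finset.mem_sdiff, Finset.mem_union, Finset.mem_image, not_or, not_exists,
        not_and] at hi hj
      have hn : (i, j) ∉ P := fun hm => hi.2.1 _ hm rfl
      refine ⟨insert (i, j) P, by rw [Finset.card_insert_of_notMem hn, hP], ?_, ?_⟩
      · intro p hp
        rcases Finset.mem_insert.mp hp with rfl | hp
        · exact ⟨hi.1, hj.1, hij, hR⟩
        · exact hP1 p hp
      · intro p hp q hq hpq
        rcases Finset.mem_insert.mp hp with rfl | hp <;>
          rcases Finset.mem_insert.mp hq with rfl | hq
        · exact absurd rfl hpq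
        · exact ⟨fun e => hi.2.1 q hq e.symm, fun e => hi.2.2 q hq e.symm,
            fun e => hj.2.1 q hq e.symm, fun e => hj.2.2 q hq e.symm⟩
        · exact ⟨hi.2.1 p hp, hj.2.1 p hp, hi.2.2 p hp, hj.2.2 p hp⟩
        · exact hP2 p hp q hq hpq
  obtain ⟨P, hP, h1, h2⟩ := key (T.card / 4) (by omega)
  exact ⟨P, by omega, h1, h2⟩

theorem ConeBound.simplexBound_two_pairs {d : ℕ} {a : ℝ} (ha : 0 ≤ a) (h : ConeBound d a) :
    SimplexBound (d + 3) (2 / (d + 3 : ℝ) + 1 / (d + 2 : ℝ) + a) := by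
  classical
  intro B hB
  obtain ⟨C, N, hC, h⟩ := h (16 * B) (by positivity)
  set D : ℝ := 8 * B * 2 ^ (1 / (d + 3 : ℝ)) with hD
  set E : ℝ := 8 * (8 * (d + 3)) ^ (1 / (d + 2 : ℝ)) with hE
  refine ⟨D * (4 * B) * (D * (4 * E)) * (C * 2 ^ a), max (16 * (d + 3)) (2 * N), by positivity,
    fun ι T u hu hT => ?_⟩
  have hTd : 16 * (d + 3 : ℝ) ≤ T.card := (le_max_left _ _).trans hT
  have hT8 : (8 : ℝ) ≤ T.card := by
    have : (0 : ℝ) ≤ d := by positivity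
    linarith
  have hT0 : (0 : ℝ) < T.card := by linarith
  have hT8' : 8 ≤ T.card := by exact_mod_cast hT8
  obtain ⟨P, hP, hP1, hP2⟩ := exists_disjoint_pairs T
    (fun i j => ‖u j - u i‖ ≤ D * (T.card : ℝ) ^ (-(1 / (d + 3 : ℝ)))) (by omega)
    (fun S hS hc => by
      obtain ⟨i, hi, j, hj, hij, hd⟩ :=
        exists_ne_norm_sub_le hB S u (fun i hi => hu i (hS hi)) (by omega)
      refine ⟨i, hi, j, hj, hij, ?_⟩
      rw [norm_sub_rev]
      refine hd.trans ?_
      have e : (((d + 2 : ℕ) : ℝ) + 1) = d + 3 := by push_cast; ring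
      rw [e, hD, mul_assoc (8 * B)]
      gcongr
      exact rpow_neg_le_of_le_mul hT0 two_pos (by positivity) (by exact_mod_cast hc))
  choose j t w hv hj hw using fun p : ι × ι => exists_eq_smul_of_norm_eq_one (u p.2 - u p.1)
  obtain ⟨k, hk⟩ := exists_card_le_mul_card_fiber P j
  have hP' : (T.card : ℝ) ≤ 8 * (d + 3) * (P.filter fun p => j p = k).card := by
    have h1 : (T.card : ℝ) ≤ 8 * P.card := by exact_mod_cast hP
    push_cast at hk
    linarith
  obtain ⟨p, hp, q, hq, hpq, hη⟩ := exists_ne_norm_sub_le one_pos (P.filter fun p => j p = k)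
    (fun p (m : Fin (d + 2)) => w p (k.succAbove m)) (fun p _ => by
      refine (pi_norm_le_iff_of_nonneg zero_le_one).mpr fun m => ?_
      exact (norm_le_pi_norm (w p) _).trans (hw p).le) (by
      have h1 : 16 * (d + 3 : ℝ) ≤ 8 * (d + 3) * (P.filter fun p => j p = k).card :=
        hTd.trans hP'
      have h2 : (2 : ℝ) ≤ (P.filter fun p => j p = k).card :=
        le_of_mul_le_mul_left (a := 8 * (d + 3 : ℝ)) (by linarith) (by positivity)
      exact_mod_cast h2)
  simp only [Finset.mem_filter] at hp hq
  obtain ⟨hp, hpk⟩ := hp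
  obtain ⟨hq, hqk⟩ := hq
  have hwη : ‖w q - w p‖ ≤ E * (T.card : ℝ) ^ (-(1 / (d + 2 : ℝ))) := by
    refine (pi_norm_le_iff_of_nonneg (by positivity)).mpr ?_
    rw [Fin.forall_iff_succAbove k]
    constructor
    · have h1 : w p k = 1 := by rw [← hpk]; exact hj p
      have h2 : w q k = 1 := by rw [← hqk]; exact hj q
      simp only [Pi.sub_apply, h1, h2, sub_self, norm_zero]
      positivity
    · intro m
      rw [Pi.sub_apply, norm_sub_rev]
      refine (norm_le_pi_norm ((fun m : Fin (d + 2) => w p (k.succAbove m)) -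
        fun m => w q (k.succAbove m)) m).trans (hη.trans ?_)
      have e : (((d + 1 : ℕ) : ℝ) + 1) = d + 2 := by push_cast; ring
      rw [e, mul_one, hE, mul_assoc 8]
      gcongr
      exact rpow_neg_le_of_le_mul hT0 (by positivity) (by positivity) hP'
  have ht : ∀ r ∈ P, |t r| ≤ D * (T.card : ℝ) ^ (-(1 / (d + 3 : ℝ))) := fun r hr => by
    have := (hP1 r hr).2.2.2
    rwa [hv r, norm_smul, hw, mul_one, Real.norm_eq_abs] at this
  obtain ⟨hpq1, hpq2, hpq3, hpq4⟩ := hP2 p hp q hq hpq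
  have hpT := hP1 p hp
  have hqT := hP1 q hq
  obtain ⟨L₁, hL₁0, hL₁, hdet₁⟩ := exists_linearMap_abs_det_cons (w p)
  obtain ⟨L₂, hL₂0, hL₂, hdet₂⟩ := exists_linearMap_abs_det_cons (L₁ (u q.1 - u p.1))
  obtain ⟨L₃, -, hL₃, hdet₃⟩ := exists_linearMap_abs_det_cons (L₂ (L₁ (u q.2 - u p.1)))
  have hsub : ∀ m ∈ T, ‖u m - u p.1‖ ≤ 2 * B := fun m hm => by
    linarith [norm_sub_le (u m) (u p.1), hu m hm, hu _ hpT.1]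
  have hz : ‖L₁ (u q.1 - u p.1)‖ ≤ 4 * B := by
    linarith [hL₁ (u q.1 - u p.1), hsub _ hqT.1]
  have hh : ‖L₂ (L₁ (u q.2 - u p.1))‖ ≤ D * (T.card : ℝ) ^ (-(1 / (d + 3 : ℝ))) *
      (4 * (E * (T.card : ℝ) ^ (-(1 / (d + 2 : ℝ))))) := by
    have e : L₂ (L₁ (u q.2 - u p.1)) = t q • L₂ (L₁ (w q - w p)) := by
      have e1 : u q.2 - u p.1 = t q • w q + (u q.1 - u p.1) := by rw [← hv q]; abel
      rw [e1, map_add, map_add, hL₂0, add_zero, map_sub, hL₁0, sub_zero, map_smul, map_smul]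
    rw [e, norm_smul, Real.norm_eq_abs]
    gcongr
    · exact ht q hq
    · linarith [hL₂ (L₁ (w q - w p)), hL₁ (w q - w p)]
  have hcard : (T.card : ℝ) ≤ 2 * (T \ {p.1, p.2, q.1, q.2}).card := by
    have h1 := Finset.le_card_sdiff {p.1, p.2, q.1, q.2} T
    have h2 : ({p.1, p.2, q.1, q.2} : Finset ι).card ≤ 4 := Finset.card_le_four
    have : T.card ≤ 2 * (T \ {p.1, p.2, q.1, q.2}).card := by omega
    exact_mod_cast this
  obtain ⟨s, hs, hsT, hb⟩ := h ι (T \ {p.1, p.2, q.1, q.2})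
    (fun m => L₃ (L₂ (L₁ (u m - u p.1)))) (fun m hm => by
      linarith [hsub m (Finset.sdiff_subset hm), hL₁ (u m - u p.1), hL₂ (L₁ (u m - u p.1)),
        hL₃ (L₂ (L₁ (u m - u p.1)))]) (by
      linarith [(le_max_right _ _).trans hT])
  simp only [Finset.mem_sdiff, Finset.mem_insert, Finset.mem_singleton, not_or] at hsT
  refine ⟨Fin.cons p.1 (Fin.cons p.2 (Fin.cons q.1 (Fin.cons q.2 s))), ?_, ?_, ?_⟩
  · simp only [Fin.cons_injective_iff, Set.mem_range, not_exists, Fin.forall_fin_succ (n := d + 2),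
      Fin.forall_fin_succ (n := d + 1), Fin.forall_fin_succ (n := d), Fin.cons_zero, Fin.cons_succ]
    exact ⟨⟨hpT.2.2.1.symm, hpq1.symm, hpq2.symm, fun x => (hsT x).2.1⟩,
      ⟨hpq3.symm, hpq4.symm, fun x => (hsT x).2.2.1⟩,
      ⟨hqT.2.2.1.symm, fun x => (hsT x).2.2.2.1⟩, fun x => (hsT x).2.2.2.2, hs⟩
  · simp only [Fin.forall_fin_succ (n := d + 3), Fin.forall_fin_succ (n := d + 2),
      Fin.forall_fin_succ (n := d + 1), Fin.forall_fin_succ (n := d), Fin.cons_zero, Fin.cons_succ]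
    exact ⟨hpT.1, hpT.2.1, hqT.1, hqT.2.1, fun x => (hsT x).1⟩
  · set σ : Fin (d + 3 + 1) → ι := Fin.cons p.1 (Fin.cons p.2 (Fin.cons q.1 (Fin.cons q.2 s)))
    have e1 : (fun m : Fin (d + 3) => u (σ m.succ) - u (σ 0)) =
        Fin.cons (t p • w p) (fun m : Fin (d + 2) => u (σ m.succ.succ) - u p.1) := by
      rw [← hv p]
      ext m k
      refine Fin.cases ?_ (fun m => ?_) m <;> simp [σ]
    have e2 : (fun m : Fin (d + 2) => L₁ (u (σ m.succ.succ) - u p.1)) =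
        Fin.cons ((1 : ℝ) • L₁ (u q.1 - u p.1))
          (fun m : Fin (d + 1) => L₁ (u (σ m.succ.succ.succ) - u p.1)) := by
      rw [one_smul]
      funext m
      exact Fin.cases rfl (fun _ => rfl) m
    have e3 : (fun m : Fin (d + 1) => L₂ (L₁ (u (σ m.succ.succ.succ) - u p.1))) =
        Fin.cons ((1 : ℝ) • L₂ (L₁ (u q.2 - u p.1)))
          (fun m : Fin d => L₂ (L₁ (u (s m) - u p.1))) := by
      rw [one_smul]
      funext m
      exact Fin.cases rfl (fun _ => rfl) m
    rw [e1, hdet₁, e2, hdet₂, e3, hdet₃, hw, abs_one, mul_one, one_mul, one_mul]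
    have e4 : (T.card : ℝ) ^ (-(2 / (d + 3 : ℝ) + 1 / (d + 2 : ℝ) + a)) =
        (T.card : ℝ) ^ (-(1 / (d + 3 : ℝ))) * (T.card : ℝ) ^ (-(1 / (d + 3 : ℝ))) *
          (T.card : ℝ) ^ (-(1 / (d + 2 : ℝ))) * (T.card : ℝ) ^ (-a) := by
      rw [← Real.rpow_add hT0, ← Real.rpow_add hT0, ← Real.rpow_add hT0]
      congr 1
      ring
    rw [e4]
    calc _ ≤ (D * (T.card : ℝ) ^ (-(1 / (d + 3 : ℝ)))) * ((4 * B) *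
          ((D * (T.card : ℝ) ^ (-(1 / (d + 3 : ℝ))) *
            (4 * (E * (T.card : ℝ) ^ (-(1 / (d + 2 : ℝ)))))) *
            (C * (2 ^ a * (T.card : ℝ) ^ (-a))))) := by
          gcongr
          · exact ht p hp
          · refine hb.trans ?_
            gcongr
            exact rpow_neg_le_of_le_mul hT0 two_pos ha hcard
      _ = _ := by ring

theorem simplexBound_seven : SimplexBound 7 (251 / 140) := by
  have h2 : ConeBound 2 1 := simplexBound_one.coneBound zero_le_one
  have h5 := h2.simplexBound_two_pairs zero_le_one
  have h6 := h5.coneBound (by positivity)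
  have h7 := h6.simplexBound_pair (by positivity)
  norm_num at h7
  exact h7

theorem vol_eq_abs_det {d : ℕ} (v : Fin d → EuclideanSpace ℝ (Fin d)) :
    vol v = |(Matrix.of fun i j => v i j).det| := by
  have : gram v = (Matrix.of fun i j => v i j) * (Matrix.of fun i j => v i j).transpose := by
    ext i j
    simp [gram, Matrix.mul_apply, PiLp.inner_apply, mul_comm]
  rw [vol, this, Matrix.det_mul, Matrix.det_transpose, Real.sqrt_mul_self_eq_abs]

theorem simplexVol_nonneg {d k : ℕ} (p : Fin (k + 1) → EuclideanSpace ℝ (Fin d)) :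
    0 ≤ simplexVol p :=
  mul_nonneg (by positivity) (Real.sqrt_nonneg _)

theorem simplexVol_le_abs_det {d : ℕ} (p : Fin (d + 1) → EuclideanSpace ℝ (Fin d)) :
    simplexVol p ≤ |(Matrix.of fun i j : Fin d => (p i.succ - p 0) j).det| := by
  rw [simplexVol, vol_eq_abs_det]
  refine mul_le_of_le_one_left (abs_nonneg _) (inv_le_one_of_one_le₀ ?_)
  exact_mod_cast Nat.one_le_iff_ne_zero.mpr (Nat.factorial_ne_zero d)

theorem minSimplexVol_le {d k : ℕ} {X : Finset (EuclideanSpace ℝ (Fin d))}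
    {p : Fin (k + 1) → EuclideanSpace ℝ (Fin d)} (hp : Function.Injective p)
    (hX : ∀ i, p i ∈ X) : minSimplexVol d k X ≤ simplexVol p := by
  refine csInf_le ⟨0, ?_⟩ ⟨p, hp, hX, rfl⟩
  rintro _ ⟨q, -, -, rfl⟩
  exact simplexVol_nonneg q

theorem minSimplexVol_le_factorial {d : ℕ} {X : Finset (EuclideanSpace ℝ (Fin d))}
    (hc : d + 1 ≤ X.card) (hX : ∀ x ∈ X, ∀ i, x i ∈ Set.Icc (0 : ℝ) 1) :
    minSimplexVol d d X ≤ d.factorial := by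
  obtain ⟨Y, hYX, hY⟩ := Finset.exists_subset_card_eq hc
  set p : Fin (d + 1) → EuclideanSpace ℝ (Fin d) := fun i => (Y.equivFinOfCardEq hY).symm i
  have hp : Function.Injective p :=
    Subtype.val_injective.comp (Y.equivFinOfCardEq hY).symm.injective
  have hpX : ∀ i, p i ∈ X := fun i => hYX ((Y.equivFinOfCardEq hY).symm i).2
  refine (minSimplexVol_le hp hpX).trans ((simplexVol_le_abs_det p).trans ?_)
  have := Matrix.det_le (A := Matrix.of fun i j : Fin d => (p i.succ - p 0) j)
    (abv := AbsoluteValue.abs) (x := 1) (fun i j => by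
      have h1 := hX _ (hpX i.succ) j
      have h2 := hX _ (hpX 0) j
      simp only [Matrix.of_apply, PiLp.sub_apply, AbsoluteValue.abs_apply, abs_le]
      constructor <;> linarith [h1.1, h1.2, h2.1, h2.2])
  simpa using this

/-- **Corollary 2 (case d = 7).** There is a constant `C > 0` such that for every
`n ≥ 8` one has `Δ_{7,7}(n) ≤ C · n^(-1.792)`: every `n`-element subset of `[0,1]^7`
contains 8 points spanning a simplex of 7-dimensional volume at most `C · n^(-1.792)`. -/
theorem delta_seven_seven :
    ∃ C : ℝ, 0 < C ∧ ∀ n : ℕ, 8 ≤ n →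
      Delta 7 7 n ≤ C * (n : ℝ) ^ ((-1.792 : ℝ)) := by
  obtain ⟨C, N, hC, h⟩ := simplexBound_seven 1 one_pos
  refine ⟨max C ((Nat.factorial 7 : ℝ) * max N 1 ^ (1.792 : ℝ)), lt_max_of_lt_left hC,
    fun n hn => ?_⟩
  have hn1 : (1 : ℝ) ≤ n := by
    have : 1 ≤ n := by omega
    exact_mod_cast this
  have hn0 : (0 : ℝ) < n := by linarith
  refine Real.sSup_le ?_ (by positivity)
  rintro _ ⟨X, rfl, hX, rfl⟩
  rcases le_or_gt N X.card with hN | hN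
  · obtain ⟨s, hs, hsX, hdet⟩ := h (EuclideanSpace ℝ (Fin 7)) X (fun x i => x i) (fun x hx => by
      refine (pi_norm_le_iff_of_nonneg zero_le_one).mpr fun i => ?_
      rw [Real.norm_eq_abs, abs_of_nonneg (hX x hx i).1]
      exact (hX x hx i).2) hN
    calc minSimplexVol 7 7 X ≤ C * (X.card : ℝ) ^ (-(251 / 140 : ℝ)) :=
          (minSimplexVol_le hs hsX).trans ((simplexVol_le_abs_det s).trans hdet)
      _ ≤ _ := by
          gcongr
          · exact le_max_left _ _
          · norm_num
  · refine (minSimplexVol_le_factorial hn hX).trans ?_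
    calc (Nat.factorial 7 : ℝ)
        = Nat.factorial 7 * ((X.card : ℝ) ^ (1.792 : ℝ) * (X.card : ℝ) ^ (-1.792 : ℝ)) := by
          rw [← Real.rpow_add hn0]
          norm_num
      _ ≤ Nat.factorial 7 * (max N 1 ^ (1.792 : ℝ) * (X.card : ℝ) ^ (-1.792 : ℝ)) := by
          gcongr
          exact le_max_of_le_left hN.le
      _ ≤ _ := by
          rw [← mul_assoc]
          gcongr
          exact le_max_right _ _
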